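/- arXiv:2209.02257 — 10 statements merged into one kernel-verified Lean document; each statement's English description precedes it below -/
import Mathlib

section
/- Let E be a real Hilbert space, let h : E → ℝ be differentiable and μ-strongly convex with μ > 0, and let η > 0. Then for all x, y ∈ E, ‖prox_{ηh}(x) − prox_{ηh}(y)‖² ≤ (1/(1 + η·μ)²)·‖x − y‖² (tight contractivity of the proximal operator). -/
open RealInnerProductSpace

/-- First-order optimality condition for a minimizer `p` of
`z ↦ η * h z + (1 / 2) * ‖z - x‖ ^ 2`. -/
theorem inner_gradient_of_prox_min
    {E : Type*} [NormedAddCommGroup E] [InnerProductSpace ℝ E] [CompleteSpace E]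
    {h : E → ℝ} {η : ℝ} {x p : E} (hd : DifferentiableAt ℝ h p)
    (hp : ∀ z : E,
      η * h p + (1 / 2) * ‖p - x‖ ^ 2 ≤ η * h z + (1 / 2) * ‖z - x‖ ^ 2) (v : E) :
    η * ⟪gradient h p, v⟫ = ⟪x - p, v⟫ := by
  have hsq := (((hasFDerivAt_id (𝕜 := ℝ) p).sub_const x).norm_sq).const_mul (1 / 2 : ℝ)
  have hsum := (hd.hasGradientAt.hasFDerivAt.const_mul η).add hsq
  have hmin : IsLocalMin
      ((fun z => η * h z) + fun z => (1 / 2 : ℝ) * ‖id z - x‖ ^ 2) p :=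
    Filter.Eventually.of_forall hp
  have hv := DFunLike.congr_fun (hmin.hasFDerivAt_eq_zero hsum) v
  rw [inner_sub_left]
  simp at hv ⊢
  linarith

/-- Tight contractivity of the proximal operator of a differentiable `μ`-strongly
convex function on a real Hilbert space:
`‖prox_{ηh}(x) − prox_{ηh}(y)‖² ≤ (1/(1+ημ)²)·‖x − y‖²`. -/
theorem prox_contraction
    {E : Type*} [NormedAddCommGroup E] [InnerProductSpace ℝ E] [CompleteSpace E]
    (h : E → ℝ) (μ η : ℝ) (hμ : 0 < μ) (hη : 0 < η)
    (hdiff : ∀ x, DifferentiableAt ℝ h x)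
    (hsc : ∀ x y : E,
      h y + ⟪gradient h y, x - y⟫ + μ / 2 * ‖x - y‖ ^ 2 ≤ h x)
    (x y px py : E)
    (hpx : ∀ z : E,
      η * h px + (1 / 2) * ‖px - x‖ ^ 2 ≤ η * h z + (1 / 2) * ‖z - x‖ ^ 2)
    (hpy : ∀ z : E,
      η * h py + (1 / 2) * ‖py - y‖ ^ 2 ≤ η * h z + (1 / 2) * ‖z - y‖ ^ 2) :
    ‖px - py‖ ^ 2 ≤ (1 / (1 + η * μ) ^ 2) * ‖x - y‖ ^ 2 := by
  have hx := inner_gradient_of_prox_min (hdiff px) hpx (px - py)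
  have hy := inner_gradient_of_prox_min (hdiff py) hpy (px - py)
  have hxy := hsc px py
  have hyx := hsc py px
  rw [← neg_sub px py, inner_neg_right, norm_neg] at hyx
  have hmono : μ * ‖px - py‖ ^ 2 ≤
      ⟪gradient h px, px - py⟫ - ⟪gradient h py, px - py⟫ := by linarith
  have hscaled := mul_le_mul_of_nonneg_left hmono hη.le
  have hinner : ⟪x - px, px - py⟫ - ⟪y - py, px - py⟫ =
      ⟪x - y, px - py⟫ - ‖px - py‖ ^ 2 := by
    rw [← real_inner_self_eq_norm_sq, ← inner_sub_left, ← inner_sub_left]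
    congr 1
    abel
  have hcs := real_inner_le_norm (x - y) (px - py)
  have hpos : 0 < 1 + η * μ := by positivity
  have hle : (1 + η * μ) * ‖px - py‖ ≤ ‖x - y‖ := by
    rcases (norm_nonneg (px - py)).eq_or_lt with h0 | h0
    · rw [← h0, mul_zero]
      exact norm_nonneg _
    · refine le_of_mul_le_mul_right ?_ h0
      linarith
  rw [one_div_mul_eq_div, le_div_iff₀ (by positivity), mul_comm, ← mul_pow]
  exact pow_le_pow_left₀ (by positivity) hle 2
end

section
/- Let f_1, …, f_M : ℝ^d → ℝ be twice continuously differentiable with average f = (1/M)·Σ_{m=1}^M f_m, and suppose that for every x ∈ ℝ^d, (1/M)·Σ_{m=1}^M ‖∇²f_m(x) − ∇²f(x)‖_op² ≤ δ², where ‖·‖_op denotes the operator norm of the Hessian (viewed as a continuous linear map). Then f_1, …, f_M satisfy δ-second-order similarity: for all x, y ∈ ℝ^d, (1/M)·Σ_{m=1}^M ‖∇f_m(x) − ∇f(x) − (∇f_m(y) − ∇f(y))‖² ≤ δ²·‖x − y‖². -/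
open RealInnerProductSpace

theorem sum_norm_sub_sq_le_of_sum_norm_fderiv_sq_le {ι E F : Type*} [Fintype ι]
    [NormedAddCommGroup E] [NormedSpace ℝ E] [NormedAddCommGroup F] [NormedSpace ℝ F]
    {h : ι → E → F} {C : ℝ} (hd : ∀ i, Differentiable ℝ (h i))
    (hC : ∀ x, ∑ i, ‖fderiv ℝ (h i) x‖ ^ 2 ≤ C) (x y : E) :
    ∑ i, ‖h i x - h i y‖ ^ 2 ≤ C * ‖x - y‖ ^ 2 := by
  have hC0 : 0 ≤ C := (Finset.sum_nonneg fun i _ => sq_nonneg _).trans (hC x)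
  let G : E → PiLp 2 (fun _ : ι => F) := fun z => WithLp.toLp 2 fun i => h i z
  have hG : ∀ z, HasFDerivAt G
      (((PiLp.continuousLinearEquiv 2 ℝ fun _ : ι => F).symm :
        (ι → F) →L[ℝ] PiLp 2 fun _ : ι => F).comp
        (ContinuousLinearMap.pi fun i => fderiv ℝ (h i) z)) z := fun z =>
    ((PiLp.continuousLinearEquiv 2 ℝ fun _ : ι => F).symm.hasFDerivAt).comp z
      (hasFDerivAt_pi.2 fun i => (hd i z).hasFDerivAt)
  have key : ‖G x - G y‖ ≤ √C * ‖x - y‖ := by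
    refine convex_univ.norm_image_sub_le_of_norm_hasFDerivWithin_le
      (fun z _ => (hG z).hasFDerivWithinAt) (fun z _ => ?_) (Set.mem_univ y) (Set.mem_univ x)
    refine ContinuousLinearMap.opNorm_le_bound _ (Real.sqrt_nonneg C) fun v => ?_
    refine le_of_sq_le_sq ?_ (by positivity)
    rw [PiLp.norm_sq_eq_of_L2, mul_pow, Real.sq_sqrt hC0]
    calc ∑ i, ‖fderiv ℝ (h i) z v‖ ^ 2
        ≤ ∑ i, ‖fderiv ℝ (h i) z‖ ^ 2 * ‖v‖ ^ 2 := by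
          gcongr with i
          rw [← mul_pow]
          gcongr
          exact ContinuousLinearMap.le_opNorm _ _
      _ ≤ C * ‖v‖ ^ 2 := by
          rw [← Finset.sum_mul]
          gcongr
          exact hC z
  calc ∑ i, ‖h i x - h i y‖ ^ 2 = ‖G x - G y‖ ^ 2 := by
        rw [PiLp.norm_sq_eq_of_L2]; rfl
    _ ≤ (√C * ‖x - y‖) ^ 2 := by gcongr
    _ = C * ‖x - y‖ ^ 2 := by rw [mul_pow, Real.sq_sqrt hC0]

theorem ContDiff.differentiable_gradient {E : Type*} [NormedAddCommGroup E]
    [InnerProductSpace ℝ E] [CompleteSpace E] {f : E → ℝ} (hf : ContDiff ℝ 2 f) :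
    Differentiable ℝ (gradient f) :=
  (InnerProductSpace.toDual ℝ E).symm.toContinuousLinearEquiv.differentiable.comp
    ((hf.fderiv_right (m := 1) (by norm_num)).differentiable (by norm_num))

/-- Hessian similarity implies second-order similarity: if each `f_m : ℝ^d → ℝ` is
twice continuously differentiable and
`(1/M)·Σ ‖∇²f_m(x) − ∇²f(x)‖_op² ≤ δ²` for all `x`, then
`(1/M)·Σ ‖∇f_m(x) − ∇f(x) − (∇f_m(y) − ∇f(y))‖² ≤ δ²‖x − y‖²` for all `x, y`,
where `f` is the average of the `f_m` and the Hessian is the (Fréchet) derivative of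
the gradient map, a continuous linear map with its operator norm. -/
theorem hessianSimilarity_implies_secondOrderSimilarity
    (d M : ℕ) (hM : 0 < M)
    (f : Fin M → EuclideanSpace ℝ (Fin d) → ℝ) (δ : ℝ)
    (hf : ∀ m, ContDiff ℝ 2 (f m))
    (hhess : ∀ x : EuclideanSpace ℝ (Fin d),
      (1 / (M : ℝ)) * ∑ m : Fin M,
          ‖fderiv ℝ (fun z => gradient (f m) z) x -
            fderiv ℝ (fun z => gradient (fun w => (1 / (M : ℝ)) * ∑ i : Fin M, f i w) z) x‖ ^ 2 ≤
        δ ^ 2) :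
    ∀ x y : EuclideanSpace ℝ (Fin d),
      (1 / (M : ℝ)) * ∑ m : Fin M,
          ‖gradient (f m) x - gradient (fun w => (1 / (M : ℝ)) * ∑ i : Fin M, f i w) x -
            (gradient (f m) y - gradient (fun w => (1 / (M : ℝ)) * ∑ i : Fin M, f i w) y)‖ ^ 2 ≤
        δ ^ 2 * ‖x - y‖ ^ 2 := by
  intro x y
  have hM' : (0 : ℝ) < M := Nat.cast_pos.2 hM
  have hg := fun m => (hf m).differentiable_gradient
  have hfbar : ContDiff ℝ 2 fun w => (1 / (M : ℝ)) * ∑ i : Fin M, f i w :=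
    contDiff_const.mul (ContDiff.sum fun i _ => hf i)
  have hgbar := hfbar.differentiable_gradient
  have key := sum_norm_sub_sq_le_of_sum_norm_fderiv_sq_le (C := M * δ ^ 2)
    (fun m => (hg m).sub hgbar) (fun z => ?_) x y
  · rw [one_div, inv_mul_le_iff₀ hM', ← mul_assoc]
    simpa only [one_div, Pi.sub_apply] using key
  · have hz := hhess z
    rw [one_div, inv_mul_le_iff₀ hM'] at hz
    simp only [fderiv_sub (hg _ z) (hgbar z)]
    simpa only [one_div] using hz
end

section
/- Let E be a real Hilbert space, let f_1, …, f_M : E → ℝ be differentiable and μ-strongly convex (μ > 0) with average f = (1/M)·Σ_{m=1}^M f_m, let x_* be a minimizer of f (so ∇f(x_*) = 0), and set σ_*² = (1/M)·Σ_{m=1}^M ‖∇f_m(x_*)‖². Then for every η > 0 and every x ∈ E, (1/M)·Σ_{m=1}^M ‖prox_{ηf_m}(x) − x_*‖² ≤ (1/(1 + η·μ)²)·( ‖x − x_*‖² + η²·σ_*² ). -/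
open RealInnerProductSpace

/-- Optimality condition of the proximal step: `η ∇h(p) = x - p`. -/
theorem smul_gradient_eq_sub_of_prox
    {E : Type*} [NormedAddCommGroup E] [InnerProductSpace ℝ E] [CompleteSpace E]
    {h : E → ℝ} {η : ℝ} {x p : E} (hdiff : DifferentiableAt ℝ h p)
    (hp : ∀ z : E, η * h p + (1 / 2) * ‖p - x‖ ^ 2 ≤ η * h z + (1 / 2) * ‖z - x‖ ^ 2) :
    η • gradient h p = x - p := by
  have hmin : IsLocalMin (fun z => η * h z + (1 / 2) * ‖z - x‖ ^ 2) p :=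
    Filter.Eventually.of_forall hp
  have hd := (hdiff.hasGradientAt.hasFDerivAt.const_mul η).add
    ((((hasFDerivAt_id p).sub_const x).norm_sq).const_mul (1 / 2))
  have hzero := hmin.hasFDerivAt_eq_zero hd
  refine ext_inner_right ℝ fun v => ?_
  have hv := DFunLike.congr_fun hzero v
  simp at hv
  rw [real_inner_smul_left, inner_sub_left, inner_gradient_left]
  linarith

/-- The gradients of the summands add up to zero at a minimizer of the sum. -/
theorem sum_gradient_eq_zero_of_forall_le
    {E ι : Type*} [NormedAddCommGroup E] [InnerProductSpace ℝ E] [CompleteSpace E] [Fintype ι]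
    {f : ι → E → ℝ} {a : E} (hdiff : ∀ i, DifferentiableAt ℝ (f i) a)
    (hmin : ∀ z, ∑ i, f i a ≤ ∑ i, f i z) :
    ∑ i, gradient (f i) a = 0 := by
  have hloc : IsLocalMin (fun z => ∑ i, f i z) a := Filter.Eventually.of_forall hmin
  have hzero := hloc.hasFDerivAt_eq_zero
    (HasFDerivAt.fun_sum fun i _ => (hdiff i).hasGradientAt.hasFDerivAt)
  refine ext_inner_right ℝ fun v => ?_
  have hv := DFunLike.congr_fun hzero v
  simpa [sum_inner] using hv

/-- Distance of the proximal point of a strongly convex function to a reference point. -/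
theorem norm_prox_sub_sq_le
    {E : Type*} [NormedAddCommGroup E] [InnerProductSpace ℝ E] [CompleteSpace E]
    {h : E → ℝ} {μ η : ℝ} {x p a : E} (hμ : 0 ≤ μ) (hη : 0 ≤ η)
    (hdiff : DifferentiableAt ℝ h p)
    (hsc : ∀ y z : E, h z + ⟪gradient h z, y - z⟫ + μ / 2 * ‖y - z‖ ^ 2 ≤ h y)
    (hp : ∀ z : E, η * h p + (1 / 2) * ‖p - x‖ ^ 2 ≤ η * h z + (1 / 2) * ‖z - x‖ ^ 2) :
    (1 + η * μ) ^ 2 * ‖p - a‖ ^ 2 ≤ ‖x - a - η • gradient h a‖ ^ 2 := by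
  have hopt := smul_gradient_eq_sub_of_prox hdiff hp
  have hmono : μ * ‖p - a‖ ^ 2 ≤ ⟪gradient h p, p - a⟫ - ⟪gradient h a, p - a⟫ := by
    have h₁ := hsc p a
    have h₂ := hsc a p
    rw [← neg_sub p a, inner_neg_right, norm_neg] at h₂
    linarith
  have hinner : (1 + η * μ) * ‖p - a‖ ^ 2 ≤ ⟪x - a - η • gradient h a, p - a⟫ := by
    have hsplit : x - a - η • gradient h a = (p - a) + η • gradient h p - η • gradient h a := by
      rw [hopt]; abel
    rw [hsplit, inner_sub_left, inner_add_left, real_inner_smul_left, real_inner_smul_left,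
      real_inner_self_eq_norm_sq]
    nlinarith [mul_le_mul_of_nonneg_left hmono hη]
  have hle : (1 + η * μ) * ‖p - a‖ ≤ ‖x - a - η • gradient h a‖ := by
    rcases (norm_nonneg (p - a)).eq_or_lt with h0 | h0
    · rw [← h0, mul_zero]
      exact norm_nonneg _
    · refine le_of_mul_le_mul_right ?_ h0
      linarith [real_inner_le_norm (x - a - η • gradient h a) (p - a)]
  rw [← mul_pow]
  have : 0 ≤ 1 + η * μ := by positivity
  gcongr

/-- One-step progress of the exact Stochastic Proximal Point Method with a uniformly
sampled client: with `σ_*² = (1/M)Σ‖∇f_m(x_*)‖²`,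
`(1/M)·Σ ‖prox_{ηf_m}(x) − x_*‖² ≤ (1/(1+ημ)²)·(‖x − x_*‖² + η²σ_*²)`. -/
theorem sppm_exact_one_step
    {E : Type*} [NormedAddCommGroup E] [InnerProductSpace ℝ E] [CompleteSpace E]
    (M : ℕ) (hM : 0 < M) (f : Fin M → E → ℝ) (μ : ℝ) (hμ : 0 < μ)
    (hdiff : ∀ m x, DifferentiableAt ℝ (f m) x)
    (hsc : ∀ m, ∀ x y : E,
      f m y + ⟪gradient (f m) y, x - y⟫ + μ / 2 * ‖x - y‖ ^ 2 ≤ f m x)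
    (xstar : E)
    (hmin : ∀ x : E,
      (1 / (M : ℝ)) * ∑ m : Fin M, f m xstar ≤ (1 / (M : ℝ)) * ∑ m : Fin M, f m x)
    (η : ℝ) (hη : 0 < η) (x : E) (p : Fin M → E)
    (hp : ∀ m, ∀ z : E,
      η * f m (p m) + (1 / 2) * ‖p m - x‖ ^ 2 ≤ η * f m z + (1 / 2) * ‖z - x‖ ^ 2) :
    (1 / (M : ℝ)) * ∑ m : Fin M, ‖p m - xstar‖ ^ 2 ≤
      (1 / (1 + η * μ) ^ 2) *
        (‖x - xstar‖ ^ 2 +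
          η ^ 2 * ((1 / (M : ℝ)) * ∑ m : Fin M, ‖gradient (f m) xstar‖ ^ 2)) := by
  have hM' : (0 : ℝ) < M := Nat.cast_pos.mpr hM
  have hgrad : ∑ m, gradient (f m) xstar = 0 :=
    sum_gradient_eq_zero_of_forall_le (fun m => hdiff m xstar) fun z =>
      le_of_mul_le_mul_left (hmin z) (by positivity)
  have hsum : (1 + η * μ) ^ 2 * ∑ m, ‖p m - xstar‖ ^ 2 ≤
      M * ‖x - xstar‖ ^ 2 + η ^ 2 * ∑ m, ‖gradient (f m) xstar‖ ^ 2 := by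
    calc (1 + η * μ) ^ 2 * ∑ m, ‖p m - xstar‖ ^ 2
        ≤ ∑ m, ‖x - xstar - η • gradient (f m) xstar‖ ^ 2 := by
          rw [Finset.mul_sum]
          exact Finset.sum_le_sum fun m _ =>
            norm_prox_sub_sq_le hμ.le hη.le (hdiff m _) (hsc m) (hp m)
      _ = M * ‖x - xstar‖ ^ 2 - 2 * η * ⟪x - xstar, ∑ m, gradient (f m) xstar⟫ +
            η ^ 2 * ∑ m, ‖gradient (f m) xstar‖ ^ 2 := by
          simp only [norm_sub_sq_real (x - xstar), real_inner_smul_right, norm_smul, mul_pow,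
            Real.norm_eq_abs, sq_abs, Finset.sum_add_distrib, Finset.sum_sub_distrib,
            inner_sum, Finset.mul_sum, Finset.sum_const, Finset.card_univ, Fintype.card_fin,
            nsmul_eq_mul, mul_assoc]
      _ = _ := by rw [hgrad, inner_zero_right]; ring
  have hc : 0 < (1 + η * μ) ^ 2 := by positivity
  rw [one_div_mul_eq_div ((1 + η * μ) ^ 2), le_div_iff₀ hc]
  calc 1 / (M : ℝ) * (∑ m, ‖p m - xstar‖ ^ 2) * (1 + η * μ) ^ 2
      = 1 / (M : ℝ) * ((1 + η * μ) ^ 2 * ∑ m, ‖p m - xstar‖ ^ 2) := by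
        ring
    _ ≤ 1 / (M : ℝ) *
          (M * ‖x - xstar‖ ^ 2 + η ^ 2 * ∑ m, ‖gradient (f m) xstar‖ ^ 2) := by gcongr
    _ = _ := by field_simp
end

section
/- Let μ > 0, σ² > 0, ε > 0, set η = μ·ε/(2σ²), let 0 ≤ b ≤ (ε/4)·(η·μ)²/(1 + η·μ)², and let (r_k)_{k≥0} be a sequence of nonnegative reals with r_0 > 0 satisfying r_{k+1} ≤ (1/(1 + η·μ))·( r_k + η²·σ² + ((1 + η·μ)²/(η·μ))·b ) for all k. Then for every natural number K with K ≥ (1 + 2σ²/(μ²·ε))·log(4·r_0/ε), we have r_K ≤ ε. (This is the iteration-complexity statement of Theorem 1 for SPPM, with r_k playing the role of E‖x_k − x_*‖².) -/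
/-- A contraction `r (k+1) ≤ (r k + t c)/(1+t)` drives `r` to `c` at rate `(1+t)⁻¹`. -/
theorem sub_mul_one_add_pow_le {r : ℕ → ℝ} {t c : ℝ} (ht : 0 < t)
    (h : ∀ k, (1 + t) * r (k + 1) ≤ r k + t * c) (k : ℕ) :
    (r k - c) * (1 + t) ^ k ≤ r 0 - c := by
  induction k with
  | zero => simp
  | succ k ih =>
    have hp : 0 < (1 + t) ^ k := by positivity
    calc (r (k + 1) - c) * (1 + t) ^ (k + 1)
        = ((1 + t) * r (k + 1) - (1 + t) * c) * (1 + t) ^ k := by ring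
      _ ≤ (r k - c) * (1 + t) ^ k := by
        refine mul_le_mul_of_nonneg_right ?_ hp.le
        linarith [h k]
      _ ≤ r 0 - c := ih

/-- `(1+t)^K` exceeds `a` once `K ≥ (1 + 1/t) log a`. -/
theorem le_one_add_pow_of_log_le {t a : ℝ} (ht : 0 < t) (ha : 0 < a) {K : ℕ}
    (hK : (1 + 1 / t) * Real.log a ≤ K) : a ≤ (1 + t) ^ K := by
  rw [← Real.log_le_log_iff ha (by positivity), Real.log_pow]
  have hlog : t / (1 + t) ≤ Real.log (1 + t) := by
    have := Real.one_sub_inv_le_log_of_pos (show 0 < 1 + t by linarith)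
    convert this using 1
    field_simp
    ring
  calc Real.log a = (1 + 1 / t) * Real.log a * (t / (1 + t)) := by
        field_simp
        ring
    _ ≤ K * (t / (1 + t)) := by gcongr
    _ ≤ K * Real.log (1 + t) := by gcongr

/-- Iteration complexity of SPPM (Theorem 1): with `η = με/(2σ²)` and
`b ≤ (ε/4)·(ημ)²/(1+ημ)²`, if the recursion
`r (k+1) ≤ (1/(1+ημ))·(r k + η²σ² + ((1+ημ)²/(ημ))·b)` holds for all `k`, then
`r K ≤ ε` for every `K ≥ (1 + 2σ²/(μ²ε))·log(4 r 0/ε)`. -/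
theorem sppm_iteration_complexity
    (μ σ2 ε : ℝ) (hμ : 0 < μ) (hσ : 0 < σ2) (hε : 0 < ε)
    (η : ℝ) (hηdef : η = μ * ε / (2 * σ2))
    (b : ℝ) (hb0 : 0 ≤ b) (hb : b ≤ (ε / 4) * (η * μ) ^ 2 / (1 + η * μ) ^ 2)
    (r : ℕ → ℝ) (hnonneg : ∀ k, 0 ≤ r k) (hr0 : 0 < r 0)
    (hrec : ∀ k : ℕ,
      r (k + 1) ≤
        (1 / (1 + η * μ)) * (r k + η ^ 2 * σ2 + ((1 + η * μ) ^ 2 / (η * μ)) * b)) :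
    ∀ K : ℕ,
      (1 + 2 * σ2 / (μ ^ 2 * ε)) * Real.log (4 * r 0 / ε) ≤ (K : ℝ) →
      r K ≤ ε := by
  intro K hK
  have hη : 0 < η := by rw [hηdef]; positivity
  have ht : 0 < η * μ := by positivity
  have hnoise : η ^ 2 * σ2 = η * μ * (ε / 2) := by
    rw [hηdef]
    field_simp
  have hinv : 2 * σ2 / (μ ^ 2 * ε) = 1 / (η * μ) := by
    rw [hηdef]
    field_simp
  have hbias : (1 + η * μ) ^ 2 / (η * μ) * b ≤ η * μ * (ε / 4) := by
    calc (1 + η * μ) ^ 2 / (η * μ) * b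
        ≤ (1 + η * μ) ^ 2 / (η * μ) * ((ε / 4) * (η * μ) ^ 2 / (1 + η * μ) ^ 2) := by gcongr
      _ = η * μ * (ε / 4) := by field_simp
  have hstep (k : ℕ) : (1 + η * μ) * r (k + 1) ≤ r k + η * μ * (3 * ε / 4) := by
    have h := hrec k
    rw [one_div_mul_eq_div, le_div_iff₀ (by positivity)] at h
    linarith
  rw [hinv] at hK
  have hpow := le_one_add_pow_of_log_le ht (by positivity) hK
  rw [div_le_iff₀ hε] at hpow
  have hdecay := sub_mul_one_add_pow_le ht hstep K
  have hp : 0 < (1 + η * μ) ^ K := by positivity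
  refine le_of_mul_le_mul_right ?_ hp
  linarith
end

section
/- Let E be a real Hilbert space, let f_1, …, f_M : E → ℝ be differentiable, μ-strongly convex (μ > 0), with average f = (1/M)·Σ_{m=1}^M f_m satisfying δ-second-order similarity, and let x_* be a minimizer of f. Fix η > 0 and points x, w ∈ E, and for each m ∈ {1,…,M} set g_m = ∇f(w) − ∇f_m(w). Then (1/M)·Σ_{m=1}^M ‖prox_{ηf_m}(x − η·g_m) − x_*‖² ≤ (1/(1 + η·μ)²)·[ ‖x − x_*‖² + η²·δ²·‖w − x_*‖² ] (the core variance-reduction step of SVRP). -/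
open RealInnerProductSpace

/-- The gradient of a finite weighted sum is the weighted sum of the gradients. -/
theorem gradient_const_mul_sum {E ι : Type*} [NormedAddCommGroup E] [InnerProductSpace ℝ E]
    [CompleteSpace E] [Fintype ι] (c : ℝ) (f : ι → E → ℝ) (x : E)
    (hf : ∀ i, DifferentiableAt ℝ (f i) x) :
    gradient (fun z => c * ∑ i, f i z) x = c • ∑ i, gradient (f i) x := by
  apply HasGradientAt.gradient
  rw [hasGradientAt_iff_hasFDerivAt]
  have h := (HasFDerivAt.fun_sum (u := Finset.univ)
    fun i _ => (hf i).hasGradientAt.hasFDerivAt).const_mul c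
  simpa only [map_smul, map_sum] using h

/-- First-order optimality condition of the proximal problem. -/
theorem smul_gradient_add_sub_eq_zero_of_forall_le {E : Type*} [NormedAddCommGroup E]
    [InnerProductSpace ℝ E] [CompleteSpace E] {f : E → ℝ} {η : ℝ} {c p : E}
    (hf : DifferentiableAt ℝ f p)
    (hp : ∀ z, η * f p + (1 / 2) * ‖p - c‖ ^ 2 ≤ η * f z + (1 / 2) * ‖z - c‖ ^ 2) :
    η • gradient f p + (p - c) = 0 := by
  have hderiv := (hf.hasGradientAt.hasFDerivAt.const_mul η).add
    ((((hasFDerivAt_id p).sub_const c).norm_sq).const_mul (1 / 2 : ℝ))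
  have hmin : IsLocalMin (fun z => η * f z + (1 / 2) * ‖z - c‖ ^ 2) p :=
    Filter.Eventually.of_forall hp
  have hzero := hmin.hasFDerivAt_eq_zero hderiv
  refine ext_inner_right ℝ fun v => ?_
  have h := DFunLike.congr_fun hzero v
  simpa [inner_add_left, inner_sub_left, inner_smul_left] using h

/-- The gradient of a `μ`-strongly convex function is `μ`-strongly monotone. -/
theorem mul_norm_sub_sq_le_inner_gradient_sub {E : Type*} [NormedAddCommGroup E]
    [InnerProductSpace ℝ E] [CompleteSpace E] {f : E → ℝ} {μ : ℝ}
    (hsc : ∀ x y, f y + ⟪gradient f y, x - y⟫ + μ / 2 * ‖x - y‖ ^ 2 ≤ f x) (x y : E) :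
    μ * ‖x - y‖ ^ 2 ≤ ⟪gradient f x - gradient f y, x - y⟫ := by
  have h₁ := hsc x y
  have h₂ := hsc y x
  rw [← neg_sub x y, norm_neg, inner_neg_right] at h₂
  rw [inner_sub_left]
  linarith

/-- For a `μ`-strongly convex `f`, the map `x ↦ x + η • ∇f x` expands distances by a factor of at
least `1 + η * μ`. -/
theorem one_add_mul_mul_norm_sub_le {E : Type*} [NormedAddCommGroup E]
    [InnerProductSpace ℝ E] [CompleteSpace E] {f : E → ℝ} {μ η : ℝ} (hη : 0 ≤ η)
    (hsc : ∀ x y, f y + ⟪gradient f y, x - y⟫ + μ / 2 * ‖x - y‖ ^ 2 ≤ f x) (x y : E) :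
    (1 + η * μ) * ‖x - y‖ ≤ ‖(x - y) + η • (gradient f x - gradient f y)‖ := by
  rcases (norm_nonneg (x - y)).eq_or_lt with h | h
  · simp [← h]
  · refine le_of_mul_le_mul_right ?_ h
    refine le_trans ?_ (real_inner_le_norm _ _)
    rw [inner_add_left, real_inner_smul_left, real_inner_self_eq_norm_sq]
    linarith [mul_le_mul_of_nonneg_left (mul_norm_sub_sq_le_inner_gradient_sub hsc x y) hη]

/-- Core variance-reduction step of SVRP: with `g_m = ∇f(w) − ∇f_m(w)`,
`(1/M)·Σ ‖prox_{ηf_m}(x − η g_m) − x_*‖² ≤ (1/(1+ημ)²)·[‖x − x_*‖² + η²δ²‖w − x_*‖²]`. -/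
theorem svrp_exact_one_step
    {E : Type*} [NormedAddCommGroup E] [InnerProductSpace ℝ E] [CompleteSpace E]
    (M : ℕ) (hM : 0 < M) (f : Fin M → E → ℝ) (μ δ : ℝ) (hμ : 0 < μ)
    (hdiff : ∀ m x, DifferentiableAt ℝ (f m) x)
    (hsc : ∀ m, ∀ x y : E,
      f m y + ⟪gradient (f m) y, x - y⟫ + μ / 2 * ‖x - y‖ ^ 2 ≤ f m x)
    (hsim : ∀ x y : E,
      (1 / (M : ℝ)) * ∑ m : Fin M,
          ‖gradient (f m) x - gradient (fun z => (1 / (M : ℝ)) * ∑ i : Fin M, f i z) x -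
            (gradient (f m) y - gradient (fun z => (1 / (M : ℝ)) * ∑ i : Fin M, f i z) y)‖ ^ 2 ≤
        δ ^ 2 * ‖x - y‖ ^ 2)
    (xstar : E)
    (hmin : ∀ x : E,
      (1 / (M : ℝ)) * ∑ m : Fin M, f m xstar ≤ (1 / (M : ℝ)) * ∑ m : Fin M, f m x)
    (η : ℝ) (hη : 0 < η) (x w : E) (g : Fin M → E)
    (hg : ∀ m,
      g m = gradient (fun z => (1 / (M : ℝ)) * ∑ i : Fin M, f i z) w - gradient (f m) w)
    (p : Fin M → E)
    (hp : ∀ m, ∀ z : E,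
      η * f m (p m) + (1 / 2) * ‖p m - (x - η • g m)‖ ^ 2 ≤
        η * f m z + (1 / 2) * ‖z - (x - η • g m)‖ ^ 2) :
    (1 / (M : ℝ)) * ∑ m : Fin M, ‖p m - xstar‖ ^ 2 ≤
      (1 / (1 + η * μ) ^ 2) *
        (‖x - xstar‖ ^ 2 + η ^ 2 * δ ^ 2 * ‖w - xstar‖ ^ 2) := by
  have hM' : (M : ℝ) ≠ 0 := by positivity
  set F : E → ℝ := fun z => (1 / (M : ℝ)) * ∑ i : Fin M, f i z with hF
  have hgrad : ∀ z, ∑ m, gradient (f m) z = (M : ℝ) • gradient F z := fun z => by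
    rw [hF, gradient_const_mul_sum _ _ _ fun i => hdiff i z, smul_smul, mul_one_div_cancel hM',
      one_smul]
  have hstar : gradient F xstar = 0 := by
    have : IsLocalMin F xstar := Filter.Eventually.of_forall hmin
    rw [gradient, this.fderiv_eq_zero, map_zero]
  set a : Fin M → E := fun m => g m + gradient (f m) xstar with ha
  have ha_sum : ∑ m, a m = 0 := by
    simp [ha, hg, Finset.sum_add_distrib, Finset.sum_sub_distrib, hgrad, hstar,
      ← Nat.cast_smul_eq_nsmul ℝ]
  have ha_sq : (1 / (M : ℝ)) * ∑ m, ‖a m‖ ^ 2 ≤ δ ^ 2 * ‖w - xstar‖ ^ 2 := by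
    refine le_of_eq_of_le ?_ (hsim w xstar)
    congr 1
    refine Finset.sum_congr rfl fun m _ => ?_
    rw [← norm_neg, hstar]
    simp only [ha, hg]
    congr 2
    module
  have hstep : ∀ m, (1 + η * μ) ^ 2 * ‖p m - xstar‖ ^ 2 ≤
      ‖x - xstar‖ ^ 2 - 2 * η * ⟪x - xstar, a m⟫ + η ^ 2 * ‖a m‖ ^ 2 := fun m => by
    have hopt := smul_gradient_add_sub_eq_zero_of_forall_le (hdiff m (p m)) (hp m)
    have hexp := one_add_mul_mul_norm_sub_le hη.le (hsc m) (p m) xstar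
    have heq : (p m - xstar) + η • (gradient (f m) (p m) - gradient (f m) xstar) =
        (x - xstar) - η • a m := by
      rw [← sub_eq_zero, ← hopt, ha]
      module
    rw [heq] at hexp
    have hsq := pow_le_pow_left₀ (by positivity) hexp 2
    rw [mul_pow, norm_sub_sq_real (x - xstar), inner_smul_right, norm_smul, mul_pow, Real.norm_eq_abs,
      sq_abs] at hsq
    linarith
  have hsum := Finset.sum_le_sum fun m (_ : m ∈ Finset.univ) => hstep m
  rw [← Finset.mul_sum, Finset.sum_add_distrib, Finset.sum_sub_distrib, ← Finset.mul_sum,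
    ← Finset.mul_sum, ← inner_sum, ha_sum, inner_zero_right, Finset.sum_const, Finset.card_univ,
    Fintype.card_fin, nsmul_eq_mul] at hsum
  rw [one_div_mul_eq_div _ (‖x - xstar‖ ^ 2 + _), le_div_iff₀ (by positivity)]
  calc (1 / (M : ℝ)) * (∑ m, ‖p m - xstar‖ ^ 2) * (1 + η * μ) ^ 2
      = (1 / (M : ℝ)) * ((1 + η * μ) ^ 2 * ∑ m, ‖p m - xstar‖ ^ 2) := by
        ring
    _ ≤ (1 / (M : ℝ)) * (M * ‖x - xstar‖ ^ 2 - 2 * η * 0 + η ^ 2 * ∑ m, ‖a m‖ ^ 2) := by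
        gcongr
    _ = ‖x - xstar‖ ^ 2 + η ^ 2 * ((1 / (M : ℝ)) * ∑ m, ‖a m‖ ^ 2) := by
        field_simp
        ring
    _ ≤ ‖x - xstar‖ ^ 2 + η ^ 2 * (δ ^ 2 * ‖w - xstar‖ ^ 2) := by gcongr
    _ = ‖x - xstar‖ ^ 2 + η ^ 2 * δ ^ 2 * ‖w - xstar‖ ^ 2 := by ring
end

section
/- Let E be a real Hilbert space, let f_1, …, f_M : E → ℝ be differentiable, μ-strongly convex (μ > 0), with average f = (1/M)·Σ_{m=1}^M f_m satisfying δ-second-order similarity, and let x_* be a minimizer of f. Fix η > 0, b ≥ 0, points x, w ∈ E; for each m set g_m = ∇f(w) − ∇f_m(w), and let x'_m ∈ E satisfy ‖x'_m − prox_{ηf_m}(x − η·g_m)‖² ≤ b. Then (1/M)·Σ_{m=1}^M ‖x'_m − x_*‖² ≤ ((1 + η·μ)/(η·μ))²·b + (1/(1 + 2η·μ))·[ ‖x − x_*‖² + η²·δ²·‖w − x_*‖² ] (one-step expected progress of inexact SVRP with client sampled uniformly from [M]). -/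
open RealInnerProductSpace

section

variable {E : Type*} [NormedAddCommGroup E] [InnerProductSpace ℝ E]

/-- First-order optimality condition for the proximal problem. -/
theorem gradient_eq_of_prox [CompleteSpace E] {h : E → ℝ} {η : ℝ} {p c : E}
    (hdiff : DifferentiableAt ℝ h p)
    (hp : ∀ z, η * h p + (1 / 2) * ‖p - c‖ ^ 2 ≤ η * h z + (1 / 2) * ‖z - c‖ ^ 2) :
    p + η • gradient h p = c := by
  have hsq : HasFDerivAt (fun z : E => ‖z - c‖ ^ 2) _ p :=
    ((hasFDerivAt_id p).sub_const c).norm_sq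
  have hder := (hdiff.hasGradientAt.hasFDerivAt.const_mul η).add (hsq.const_mul (1 / 2))
  have hmin : IsLocalMin (fun z => η * h z + (1 / 2) * ‖z - c‖ ^ 2) p :=
    Filter.Eventually.of_forall hp
  have hzero := hmin.hasFDerivAt_eq_zero hder
  refine sub_eq_zero.mp (ext_inner_right ℝ fun v => ?_)
  have hv := DFunLike.congr_fun hzero v
  simp at hv
  simp only [inner_sub_left, inner_add_left, real_inner_smul_left, inner_zero_left, gradient,
    InnerProductSpace.toDual_symm_apply]
  linarith

/-- The gradient of an average is the average of the gradients. -/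
theorem gradient_average [CompleteSpace E] {M : ℕ} {f : Fin M → E → ℝ}
    (hdiff : ∀ m x, DifferentiableAt ℝ (f m) x) (x : E) :
    gradient (fun z => (1 / (M : ℝ)) * ∑ i : Fin M, f i z) x =
      (1 / (M : ℝ)) • ∑ i : Fin M, gradient (f i) x := by
  apply HasGradientAt.gradient
  rw [hasGradientAt_iff_hasFDerivAt, map_smul, map_sum]
  exact (HasFDerivAt.fun_sum fun i _ => (hdiff i x).hasGradientAt.hasFDerivAt).const_mul _

/-- Strong monotonicity of the gradient of a strongly convex function. -/
theorem strongly_monotone_gradient [CompleteSpace E] {h : E → ℝ} {μ : ℝ}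
    (hsc : ∀ x y : E, h y + ⟪gradient h y, x - y⟫ + μ / 2 * ‖x - y‖ ^ 2 ≤ h x) (x y : E) :
    μ * ‖x - y‖ ^ 2 ≤ ⟪gradient h x - gradient h y, x - y⟫ := by
  have hxy := hsc x y
  have hyx := hsc y x
  rw [norm_sub_rev y x, ← neg_sub x y, inner_neg_right] at hyx
  rw [inner_sub_left]
  linarith

/-- The map `u ↦ u + η v`, with `v` strongly monotone in `u`, expands norms by `1 + ημ`. -/
theorem norm_sq_le_of_strongly_monotone {η μ : ℝ} (hη : 0 ≤ η) (hμ : 0 ≤ μ) {u v : E}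
    (huv : μ * ‖u‖ ^ 2 ≤ ⟪v, u⟫) :
    (1 + η * μ) ^ 2 * ‖u‖ ^ 2 ≤ ‖u + η • v‖ ^ 2 := by
  have hpos : 0 ≤ ‖(u + η • v) - (1 + η * μ) • u‖ ^ 2 := sq_nonneg _
  rw [norm_sub_sq_real, norm_smul, mul_pow, Real.norm_eq_abs, sq_abs, real_inner_smul_right,
    inner_add_left, real_inner_smul_left, real_inner_self_eq_norm_sq] at hpos
  have hημ : 0 ≤ 1 + η * μ := by positivity
  have hmul := mul_le_mul_of_nonneg_left (mul_le_mul_of_nonneg_left huv hη) hημ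
  nlinarith

/-- Young's inequality with the weights balancing a contraction by `1 + t`. -/
theorem norm_add_sq_le_of_pos {V : Type*} [SeminormedAddCommGroup V] {t : ℝ} (ht : 0 < t)
    (a u : V) :
    ‖a + u‖ ^ 2 ≤ ((1 + t) / t) ^ 2 * ‖a‖ ^ 2 + (1 + t) ^ 2 / (1 + 2 * t) * ‖u‖ ^ 2 := by
  have hle : ‖a + u‖ ^ 2 ≤ (‖a‖ + ‖u‖) ^ 2 := by gcongr; exact norm_add_le a u
  refine hle.trans (sub_nonneg.mp ?_)
  have hid : ((1 + t) / t) ^ 2 * ‖a‖ ^ 2 + (1 + t) ^ 2 / (1 + 2 * t) * ‖u‖ ^ 2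
      - (‖a‖ + ‖u‖) ^ 2 = ((1 + 2 * t) * ‖a‖ - t ^ 2 * ‖u‖) ^ 2 / (t ^ 2 * (1 + 2 * t)) := by
    field_simp
    ring
  rw [hid]
  positivity

/-- A mean-zero perturbation shifts the mean square by its own mean square. -/
theorem sum_norm_sub_smul_sq {M : ℕ} (a : E) (η : ℝ) {d : Fin M → E} (hd : ∑ m, d m = 0) :
    ∑ m, ‖a - η • d m‖ ^ 2 = M * ‖a‖ ^ 2 + η ^ 2 * ∑ m, ‖d m‖ ^ 2 := by
  have hcross : ∑ m, ⟪a, d m⟫ = 0 := by rw [← inner_sum, hd, inner_zero_right]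
  simp only [norm_sub_sq_real, norm_smul, mul_pow, Real.norm_eq_abs, sq_abs,
    real_inner_smul_right, Finset.sum_add_distrib, Finset.sum_sub_distrib, ← Finset.mul_sum,
    hcross]
  simp

end

/-- One-step expected progress of inexact SVRP with a uniformly sampled client: with
`g_m = ∇f(w) − ∇f_m(w)` and `‖x'_m − prox_{ηf_m}(x − η g_m)‖² ≤ b`,
`(1/M)·Σ ‖x'_m − x_*‖² ≤ ((1+ημ)/(ημ))²·b + (1/(1+2ημ))·[‖x − x_*‖² + η²δ²‖w − x_*‖²]`. -/
theorem svrp_inexact_one_step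
    {E : Type*} [NormedAddCommGroup E] [InnerProductSpace ℝ E] [CompleteSpace E]
    (M : ℕ) (hM : 0 < M) (f : Fin M → E → ℝ) (μ δ : ℝ) (hμ : 0 < μ)
    (hdiff : ∀ m x, DifferentiableAt ℝ (f m) x)
    (hsc : ∀ m, ∀ x y : E,
      f m y + ⟪gradient (f m) y, x - y⟫ + μ / 2 * ‖x - y‖ ^ 2 ≤ f m x)
    (hsim : ∀ x y : E,
      (1 / (M : ℝ)) * ∑ m : Fin M,
          ‖gradient (f m) x - gradient (fun z => (1 / (M : ℝ)) * ∑ i : Fin M, f i z) x -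
            (gradient (f m) y - gradient (fun z => (1 / (M : ℝ)) * ∑ i : Fin M, f i z) y)‖ ^ 2 ≤
        δ ^ 2 * ‖x - y‖ ^ 2)
    (xstar : E)
    (hmin : ∀ x : E,
      (1 / (M : ℝ)) * ∑ m : Fin M, f m xstar ≤ (1 / (M : ℝ)) * ∑ m : Fin M, f m x)
    (η b : ℝ) (hη : 0 < η) (hb : 0 ≤ b) (x w : E) (g : Fin M → E)
    (hg : ∀ m,
      g m = gradient (fun z => (1 / (M : ℝ)) * ∑ i : Fin M, f i z) w - gradient (f m) w)
    (p x' : Fin M → E)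
    (hp : ∀ m, ∀ z : E,
      η * f m (p m) + (1 / 2) * ‖p m - (x - η • g m)‖ ^ 2 ≤
        η * f m z + (1 / 2) * ‖z - (x - η • g m)‖ ^ 2)
    (hx' : ∀ m, ‖x' m - p m‖ ^ 2 ≤ b) :
    (1 / (M : ℝ)) * ∑ m : Fin M, ‖x' m - xstar‖ ^ 2 ≤
      ((1 + η * μ) / (η * μ)) ^ 2 * b +
        (1 / (1 + 2 * η * μ)) *
          (‖x - xstar‖ ^ 2 + η ^ 2 * δ ^ 2 * ‖w - xstar‖ ^ 2) := by
  have hM' : (0 : ℝ) < M := Nat.cast_pos.mpr hM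
  set F : E → ℝ := fun z => (1 / (M : ℝ)) * ∑ i : Fin M, f i z with hF
  have hgrad : ∀ y, ∑ m, gradient (f m) y = (M : ℝ) • gradient F y := fun y => by
    rw [hF, gradient_average hdiff, smul_smul, mul_one_div_cancel hM'.ne', one_smul]
  have hstar : gradient F xstar = 0 := by
    have hloc : IsLocalMin F xstar := Filter.Eventually.of_forall hmin
    simp [gradient, hloc.fderiv_eq_zero]
  set d : Fin M → E := fun m =>
    gradient F w - gradient (f m) w - (gradient F xstar - gradient (f m) xstar) with hd
  have hdsum : ∑ m, d m = 0 := by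
    simp only [hd, Finset.sum_sub_distrib, hgrad]
    simp [← Nat.cast_smul_eq_nsmul ℝ]
  have hdsq : ∑ m, ‖d m‖ ^ 2 ≤ M * (δ ^ 2 * ‖w - xstar‖ ^ 2) := by
    have h := hsim w xstar
    rw [one_div, inv_mul_le_iff₀ hM'] at h
    refine le_of_eq_of_le (Finset.sum_congr rfl fun m _ => ?_) h
    rw [← norm_neg]
    congr 2
    simp only [hd]
    abel
  have hcontr : ∀ m, (1 + η * μ) ^ 2 * ‖p m - xstar‖ ^ 2 ≤ ‖(x - xstar) - η • d m‖ ^ 2 := by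
    intro m
    have hprox := gradient_eq_of_prox (hdiff m (p m)) (hp m)
    convert norm_sq_le_of_strongly_monotone hη.le hμ.le
      (strongly_monotone_gradient (hsc m) (p m) xstar) using 3
    rw [hg m] at hprox
    simp only [hd, hstar]
    linear_combination (norm := module) (-1 : ℝ) • hprox
  have hημ : 0 < η * μ := mul_pos hη hμ
  have hpoint : ∀ m, ‖x' m - xstar‖ ^ 2 ≤ ((1 + η * μ) / (η * μ)) ^ 2 * b +
      1 / (1 + 2 * η * μ) * ‖(x - xstar) - η • d m‖ ^ 2 := by
    intro m
    rw [← sub_add_sub_cancel (x' m) (p m) xstar]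
    refine (norm_add_sq_le_of_pos hημ _ _).trans ?_
    rw [mul_assoc 2 η μ, div_mul_eq_mul_div, one_div_mul_eq_div]
    gcongr
    · exact hx' m
    · exact hcontr m
  have hsum := Finset.sum_le_sum fun m (_ : m ∈ Finset.univ) => hpoint m
  rw [Finset.sum_add_distrib, ← Finset.mul_sum, ← Finset.mul_sum, sum_norm_sub_smul_sq _ _ hdsum,
    Finset.sum_const, Finset.card_univ, Fintype.card_fin, nsmul_eq_mul] at hsum
  rw [one_div, inv_mul_le_iff₀ hM']
  linear_combination hsum + 1 / (1 + 2 * η * μ) * η ^ 2 * hdsq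
end

section
/- Let μ > 0, δ > 0, η > 0, p ∈ (0, 1], b ≥ 0, and set τ = min{ η·μ/(1 + 2η·μ), p/2 }. Let (V_k)_{k≥0} be a sequence of nonnegative reals satisfying V_{k+1} ≤ (1 − τ)·V_k + ((1 + η·μ)³/(η·μ)²)·b for all k, let (r_k)_{k≥0} be nonnegative reals with r_k ≤ V_k for all k, and suppose V_0 = (1 + η·μ/p)·r_0. Then for every k, r_k ≤ (1 + η·μ/p)·(1 − τ)^k·r_0 + ((1 + η·μ)³/((η·μ)²·τ))·b. Moreover, with the choices η = μ/(2δ²), p = 1/M (for a positive integer M), b ≤ ε·τ·(η·μ)²/(2·(1 + η·μ)³) for some ε > 0, and r_0 > 0, every natural number K with K ≥ (1/τ)·log( 2·r_0·(1 + η·μ/p)/ε ) satisfies r_K ≤ ε. (This is the deterministic core of Theorem 2 on the convergence of SVRP, with r_k playing the role of E‖x_k − x_*‖² and V_k the expected Lyapunov function.) -/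
/-- A nonexpansive affine recursion `V (k + 1) ≤ (1 - τ) V k + c` contracts geometrically up to
the error `c / τ`. -/
theorem le_geometric_add_of_affine_recursion {V : ℕ → ℝ} {τ c : ℝ} (hτ0 : 0 < τ) (hτ1 : τ ≤ 1)
    (hc : 0 ≤ c) (hV : ∀ k, V (k + 1) ≤ (1 - τ) * V k + c) (k : ℕ) :
    V k ≤ (1 - τ) ^ k * V 0 + c / τ := by
  induction k with
  | zero =>
    have : 0 ≤ c / τ := by positivity
    simpa using this
  | succ k ih =>
    calc V (k + 1) ≤ (1 - τ) * V k + c := hV k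
      _ ≤ (1 - τ) * ((1 - τ) ^ k * V 0 + c / τ) + c := by
        have := sub_nonneg.2 hτ1
        gcongr
      _ = (1 - τ) ^ (k + 1) * V 0 + c / τ := by
        field_simp
        ring

/-- After `log A / τ` steps, contraction by `1 - τ` absorbs the factor `A`. -/
theorem one_sub_pow_mul_le_one {τ A : ℝ} (hτ0 : 0 < τ) (hτ1 : τ ≤ 1) (hA : 0 < A) {K : ℕ}
    (hK : 1 / τ * Real.log A ≤ K) : (1 - τ) ^ K * A ≤ 1 := by
  have hlog : Real.log A ≤ K * τ := by
    rwa [one_div_mul_eq_div, div_le_iff₀ hτ0] at hK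
  calc (1 - τ) ^ K * A ≤ Real.exp (-τ) ^ K * Real.exp (K * τ) := by
        have := sub_nonneg.2 hτ1
        gcongr
        · exact Real.one_sub_le_exp_neg τ
        · exact (Real.log_le_iff_le_exp hA).1 hlog
    _ = 1 := by
        rw [← Real.exp_nat_mul, ← Real.exp_add]
        simp

/-- Deterministic core of Theorem 2 (convergence of SVRP): with
`τ = min(ημ/(1+2ημ), p/2)`, if `V (k+1) ≤ (1−τ)·V k + ((1+ημ)³/(ημ)²)·b`,
`r k ≤ V k`, and `V 0 = (1 + ημ/p)·r 0`, then
`r k ≤ (1 + ημ/p)·(1−τ)^k·r 0 + ((1+ημ)³/((ημ)²τ))·b` for all `k`;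
moreover with `η = μ/(2δ²)`, `p = 1/M`, `b ≤ ε·τ·(ημ)²/(2(1+ημ)³)`, `r 0 > 0`,
every `K` with `K ≥ (1/τ)·log(2 r 0 (1 + ημ/p)/ε)` satisfies `r K ≤ ε`. -/
theorem svrp_convergence_core
    (μ δ η p b τ : ℝ) (hμ : 0 < μ) (hδ : 0 < δ) (hη : 0 < η)
    (hp0 : 0 < p) (hp1 : p ≤ 1) (hb : 0 ≤ b)
    (hτ : τ = min (η * μ / (1 + 2 * η * μ)) (p / 2))
    (V r : ℕ → ℝ)
    (hVnonneg : ∀ k, 0 ≤ V k) (hrnonneg : ∀ k, 0 ≤ r k)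
    (hVrec : ∀ k, V (k + 1) ≤ (1 - τ) * V k + ((1 + η * μ) ^ 3 / (η * μ) ^ 2) * b)
    (hrV : ∀ k, r k ≤ V k)
    (hV0 : V 0 = (1 + η * μ / p) * r 0) :
    (∀ k : ℕ,
        r k ≤ (1 + η * μ / p) * (1 - τ) ^ k * r 0 +
          ((1 + η * μ) ^ 3 / ((η * μ) ^ 2 * τ)) * b) ∧
      (∀ M : ℕ, 0 < M → η = μ / (2 * δ ^ 2) → p = 1 / (M : ℝ) →
        ∀ ε : ℝ, 0 < ε → b ≤ ε * τ * (η * μ) ^ 2 / (2 * (1 + η * μ) ^ 3) →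
          0 < r 0 →
          ∀ K : ℕ,
            (1 / τ) * Real.log (2 * r 0 * (1 + η * μ / p) / ε) ≤ (K : ℝ) →
            r K ≤ ε) := by
  have hτ0 : 0 < τ := by
    rw [hτ]
    positivity
  have hτ1 : τ ≤ 1 := by
    have := min_le_right (η * μ / (1 + 2 * η * μ)) (p / 2)
    linarith
  have bound : ∀ k : ℕ, r k ≤ (1 + η * μ / p) * (1 - τ) ^ k * r 0 +
      ((1 + η * μ) ^ 3 / ((η * μ) ^ 2 * τ)) * b := fun k => by
    have hV := le_geometric_add_of_affine_recursion hτ0 hτ1 (by positivity) hVrec k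
    rw [hV0] at hV
    calc r k ≤ _ := (hrV k).trans hV
      _ = _ := by
        field_simp
  refine ⟨bound, fun M _ _ _ ε hε hbε hr0 K hK => (bound K).trans ?_⟩
  have hcontr := one_sub_pow_mul_le_one hτ0 hτ1 (by positivity) hK
  have hfirst : (1 + η * μ / p) * (1 - τ) ^ K * r 0 ≤ ε / 2 := by
    calc (1 + η * μ / p) * (1 - τ) ^ K * r 0
        = (1 - τ) ^ K * (2 * r 0 * (1 + η * μ / p) / ε) * (ε / 2) := by
          field_simp
      _ ≤ 1 * (ε / 2) := by gcongr
      _ = ε / 2 := one_mul _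
  have hsecond : (1 + η * μ) ^ 3 / ((η * μ) ^ 2 * τ) * b ≤ ε / 2 := by
    calc (1 + η * μ) ^ 3 / ((η * μ) ^ 2 * τ) * b
        ≤ (1 + η * μ) ^ 3 / ((η * μ) ^ 2 * τ) *
            (ε * τ * (η * μ) ^ 2 / (2 * (1 + η * μ) ^ 3)) := by gcongr
      _ = ε / 2 := by
        field_simp
  linarith
end

section
/- Let E be a real Hilbert space, let h : E → ℝ be μ-strongly convex (μ > 0) but not necessarily differentiable, meaning the function z ↦ h(z) − (μ/2)‖z‖² is convex, and let η > 0. Suppose p_x is a minimizer of z ↦ η·h(z) + (1/2)·‖z − x‖² and p_y is a minimizer of z ↦ η·h(z) + (1/2)·‖z − y‖². Then ‖p_x − p_y‖² ≤ (1/(1 + η·μ)²)·‖x − y‖². -/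
open RealInnerProductSpace

/-- A minimizer of a strongly convex function satisfies the quadratic growth inequality. -/
lemma StrongConvexOn.quadratic_growth {E : Type*} [NormedAddCommGroup E] [NormedSpace ℝ E]
    {s : Set E} {f : E → ℝ} {m : ℝ} (hf : StrongConvexOn s m f) {p z : E} (hp : p ∈ s)
    (hmin : IsMinOn f s p) (hz : z ∈ s) : f p + m / 2 * ‖z - p‖ ^ 2 ≤ f z := by
  set c := m / 2 * ‖z - p‖ ^ 2
  have hpz : f p ≤ f z := hmin hz
  by_contra! hlt
  have hcpos : 0 < c := by linarith
  set t := (c - (f z - f p)) / (2 * c)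
  have htc : t * (2 * c) = c - (f z - f p) := div_mul_cancel₀ _ (by positivity)
  have ht0 : 0 < t := div_pos (by linarith) (by positivity)
  have ht1 : t ≤ 1 := (div_le_one (by positivity)).2 (by linarith)
  have hseg : f (t • z + (1 - t) • p) ≤ t * f z + (1 - t) * f p - t * (1 - t) * c :=
    hf.2 hz hp ht0.le (sub_nonneg.2 ht1) (by ring)
  have hle : f p ≤ f (t • z + (1 - t) • p) :=
    hmin (hf.1 hz hp ht0.le (sub_nonneg.2 ht1) (by ring))
  have hmul : t * ((1 - t) * c) ≤ t * (f z - f p) := by linarith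
  linarith [le_of_mul_le_mul_left hmul ht0]

/-- The objective defining the proximal point of a `μ`-strongly convex function is
`(1 + η * μ)`-strongly convex. -/
lemma StrongConvexOn.prox_objective {E : Type*} [NormedAddCommGroup E] [InnerProductSpace ℝ E]
    {s : Set E} {h : E → ℝ} {μ η : ℝ} (hη : 0 ≤ η) (hh : StrongConvexOn s μ h) (x : E) :
    StrongConvexOn s (1 + η * μ) (fun z => η * h z + (1 / 2) * ‖z - x‖ ^ 2) := by
  rw [strongConvexOn_iff_convex] at hh ⊢
  have hlin : ConvexOn ℝ s (fun z => -(innerSL ℝ x).toLinearMap z) :=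
    ((innerSL ℝ x).toLinearMap.concaveOn hh.1).neg
  refine (((hh.smul hη).add hlin).add_const ((1 / 2) * ‖x‖ ^ 2)).congr fun z _ => ?_
  simp only [Pi.add_apply, smul_eq_mul, ContinuousLinearMap.coe_coe, innerSL_apply_apply]
  rw [norm_sub_sq_real, real_inner_comm z x]
  ring

/-- Tight contractivity of the proximal operator for a possibly nondifferentiable
`μ`-strongly convex function (`z ↦ h(z) − (μ/2)‖z‖²` convex):
`‖prox_{ηh}(x) − prox_{ηh}(y)‖² ≤ (1/(1+ημ)²)·‖x − y‖²`. -/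
theorem prox_contraction_nonsmooth
    {E : Type*} [NormedAddCommGroup E] [InnerProductSpace ℝ E] [CompleteSpace E]
    (h : E → ℝ) (μ η : ℝ) (hμ : 0 < μ) (hη : 0 < η)
    (hsc : ConvexOn ℝ Set.univ (fun z => h z - μ / 2 * ‖z‖ ^ 2))
    (x y px py : E)
    (hpx : ∀ z : E,
      η * h px + (1 / 2) * ‖px - x‖ ^ 2 ≤ η * h z + (1 / 2) * ‖z - x‖ ^ 2)
    (hpy : ∀ z : E,
      η * h py + (1 / 2) * ‖py - y‖ ^ 2 ≤ η * h z + (1 / 2) * ‖z - y‖ ^ 2) :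
    ‖px - py‖ ^ 2 ≤ (1 / (1 + η * μ) ^ 2) * ‖x - y‖ ^ 2 := by
  have hconv := fun w => (strongConvexOn_iff_convex.2 hsc).prox_objective hη.le w
  have hx := (hconv x).quadratic_growth (Set.mem_univ px) (fun z _ => hpx z) (Set.mem_univ py)
  have hy := (hconv y).quadratic_growth (Set.mem_univ py) (fun z _ => hpy z) (Set.mem_univ px)
  have hm : 0 < 1 + η * μ := by positivity
  have hmono : (1 + η * μ) * ‖px - py‖ ^ 2 ≤ ⟪x - y, px - py⟫ := by
    simp only [norm_sub_sq_real py px, norm_sub_sq_real _ x, norm_sub_sq_real _ y,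
      norm_sub_sq_real px py, inner_sub_left, inner_sub_right, real_inner_comm px py,
      real_inner_comm _ x, real_inner_comm _ y] at hx hy ⊢
    linarith
  have hcs : (1 + η * μ) * ‖px - py‖ ≤ ‖x - y‖ := by
    rcases (norm_nonneg (px - py)).eq_or_lt with h0 | hpos
    · simp [← h0]
    · refine le_of_mul_le_mul_right ?_ hpos
      linarith [real_inner_le_norm (x - y) (px - py)]
  rw [one_div_mul_eq_div, le_div_iff₀ (by positivity), mul_comm, ← mul_pow]
  gcongr
end

section
/- Let E be a real Hilbert space, let f_1, …, f_M : E → ℝ be differentiable and convex with average f = (1/M)·Σ_{m=1}^M f_m, let R : E → ℝ be convex, and let x_* be a minimizer over E of F = f + R. Then for every η > 0 and every m ∈ {1,…,M}, x_* is a minimizer over z ∈ E of the function z ↦ η·( f_m(z) + R(z) ) + (1/2)·‖z − ( x_* + η·∇f_m(x_*) − η·∇f(x_*) )‖²; that is, x_* = prox_{η(f_m + R)}( x_* + η·∇f_m(x_*) − η·∇f(x_*) ). -/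
open RealInnerProductSpace

/-- First-order optimality for a composite objective: if `x` minimizes `ψ + R`, with `R` convex and
`ψ` differentiable at `x`, then `-ψ'` is a subgradient of `R` at `x`. -/
theorem ConvexOn.le_add_fderiv_of_forall_add_le
    {E : Type*} [NormedAddCommGroup E] [NormedSpace ℝ E] {ψ R : E → ℝ} {ψ' : E →L[ℝ] ℝ} {x : E}
    (hR : ConvexOn ℝ Set.univ R) (hψ : HasFDerivAt ψ ψ' x)
    (hmin : ∀ y, ψ x + R x ≤ ψ y + R y) (z : E) :
    R x ≤ R z + ψ' (z - x) := by
  have hline : HasDerivAt (fun t : ℝ => ψ (x + t • (z - x))) (ψ' (z - x)) 0 :=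
    hψ.hasLineDerivAt (z - x)
  have hslope := hline.tendsto_slope_zero_right
  have hge : R x - R z ≤ ψ' (z - x) := by
    refine ge_of_tendsto hslope ?_
    filter_upwards [Ioc_mem_nhdsGT (zero_lt_one' ℝ)] with t ⟨ht0, ht1⟩
    have hc : R (x + t • (z - x)) ≤ (1 - t) * R x + t * R z := by
      have h := hR.2 (Set.mem_univ x) (Set.mem_univ z) (sub_nonneg.2 ht1) ht0.le (by ring)
      rw [show x + t • (z - x) = (1 - t) • x + t • z by module]
      simpa only [smul_eq_mul] using h
    have hm := hmin (x + t • (z - x))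
    simp only [zero_add, zero_smul, add_zero, smul_eq_mul]
    rw [inv_mul_eq_div, le_div_iff₀ ht0]
    linarith
  linarith

/-- A convex function lies above its tangent at any point of differentiability. -/
theorem ConvexOn.add_fderiv_le {E : Type*} [NormedAddCommGroup E] [NormedSpace ℝ E]
    {g : E → ℝ} {g' : E →L[ℝ] ℝ} {x : E} (hg : ConvexOn ℝ Set.univ g) (hg' : HasFDerivAt g g' x)
    (z : E) : g x + g' (z - x) ≤ g z := by
  have h := hg.le_add_fderiv_of_forall_add_le hg'.neg (by simp) z
  simp only [neg_apply] at h
  linarith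

/-- Composite prox fixed-point fact: if `x_*` minimizes `F = f + R` with
`f = (1/M)Σ f_m` (each `f_m` differentiable and convex, `R` convex), then for every
`η > 0` and every `m`, `x_*` minimizes
`z ↦ η(f_m(z) + R(z)) + (1/2)‖z − (x_* + η∇f_m(x_*) − η∇f(x_*))‖²`,
i.e. `x_* = prox_{η(f_m + R)}(x_* + η∇f_m(x_*) − η∇f(x_*))`. -/
theorem composite_prox_fixed_point
    {E : Type*} [NormedAddCommGroup E] [InnerProductSpace ℝ E] [CompleteSpace E]
    (M : ℕ) (hM : 0 < M) (f : Fin M → E → ℝ)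
    (hdiff : ∀ m x, DifferentiableAt ℝ (f m) x)
    (hconv : ∀ m, ConvexOn ℝ Set.univ (f m))
    (R : E → ℝ) (hR : ConvexOn ℝ Set.univ R)
    (xstar : E)
    (hmin : ∀ x : E,
      ((1 / (M : ℝ)) * ∑ m : Fin M, f m xstar) + R xstar ≤
        ((1 / (M : ℝ)) * ∑ m : Fin M, f m x) + R x) :
    ∀ (η : ℝ), 0 < η → ∀ m : Fin M, ∀ z : E,
      η * (f m xstar + R xstar) +
          (1 / 2) * ‖xstar - (xstar + η • gradient (f m) xstar -
            η • gradient (fun u => (1 / (M : ℝ)) * ∑ i : Fin M, f i u) xstar)‖ ^ 2 ≤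
        η * (f m z + R z) +
          (1 / 2) * ‖z - (xstar + η • gradient (f m) xstar -
            η • gradient (fun u => (1 / (M : ℝ)) * ∑ i : Fin M, f i u) xstar)‖ ^ 2 := by
  intro η hη m z
  have havg : DifferentiableAt ℝ (fun u => (1 / (M : ℝ)) * ∑ i : Fin M, f i u) xstar :=
    (DifferentiableAt.fun_sum fun i _ => hdiff i xstar).const_mul _
  have hsub := hR.le_add_fderiv_of_forall_add_le havg.hasGradientAt.hasFDerivAt hmin z
  have htan := (hconv m).add_fderiv_le (hdiff m xstar).hasGradientAt.hasFDerivAt z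
  rw [InnerProductSpace.toDual_apply_apply] at hsub htan
  set a := gradient (f m) xstar
  set b := gradient (fun u => (1 / (M : ℝ)) * ∑ i : Fin M, f i u) xstar
  have hnorm : ‖z - (xstar + η • a - η • b)‖ ^ 2 =
      ‖z - xstar‖ ^ 2 - 2 * (η * (⟪a, z - xstar⟫ - ⟪b, z - xstar⟫)) +
        ‖xstar - (xstar + η • a - η • b)‖ ^ 2 := by
    rw [show z - (xstar + η • a - η • b) = (z - xstar) - η • (a - b) by module,
      show xstar - (xstar + η • a - η • b) = -(η • (a - b)) by module, norm_neg,
      norm_sub_sq_real, real_inner_smul_right, real_inner_comm, inner_sub_left]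
  rw [hnorm]
  have hscaled := mul_le_mul_of_nonneg_left (add_le_add hsub htan) hη.le
  linarith [sq_nonneg ‖z - xstar‖]
end

section
/- Let E be a real Hilbert space, let f_1, …, f_M : E → ℝ be differentiable, μ-strongly convex (μ > 0), with average f = (1/M)·Σ_{m=1}^M f_m satisfying δ-second-order similarity, let R : E → ℝ be convex, and let x_* be a minimizer of F = f + R. Fix η > 0 and points x, w ∈ E, and for each m ∈ {1,…,M} set g_m = ∇f(w) − ∇f_m(w). Then (1/M)·Σ_{m=1}^M ‖prox_{η(f_m + R)}(x − η·g_m) − x_*‖² ≤ (1/(1 + η·μ)²)·[ ‖x − x_*‖² + η²·δ²·‖w − x_*‖² ] (the core variance-reduction step of SVRP for composite/constrained optimization). -/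
open RealInnerProductSpace

/-- First-order optimality condition for a composite objective `h + R`. -/
lemma sub_le_fderiv_of_isMin_add_convex {E : Type*} [NormedAddCommGroup E] [NormedSpace ℝ E]
    {h R : E → ℝ} {L : E →L[ℝ] ℝ} {p : E} (hL : HasFDerivAt h L p)
    (hR : ConvexOn ℝ Set.univ R) (hmin : ∀ z, h p + R p ≤ h z + R z) (z : E) :
    R p - R z ≤ L (z - p) := by
  have hline : HasDerivAt (fun t : ℝ => h (p + t • (z - p))) (L (z - p)) 0 := by
    have h1 : HasDerivAt (fun t : ℝ => p + t • (z - p)) (z - p) 0 := by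
      simpa using ((hasDerivAt_id (0 : ℝ)).smul_const (z - p)).const_add p
    have h2 : HasFDerivAt h L (p + (0 : ℝ) • (z - p)) := by simpa using hL
    exact h2.comp_hasDerivAt (0 : ℝ) h1
  have hslope := hline.tendsto_slope_zero_right
  refine ge_of_tendsto hslope ?_
  filter_upwards [Ioo_mem_nhdsGT (zero_lt_one' ℝ)] with t ht
  have hconv := hR.2 (Set.mem_univ p) (Set.mem_univ z) (sub_nonneg.2 ht.2.le) ht.1.le
    (sub_add_cancel 1 t)
  have hpt : (1 - t) • p + t • z = p + t • (z - p) := by module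
  rw [hpt] at hconv
  have hle := hmin (p + t • (z - p))
  simp only [smul_eq_mul] at hconv
  simp only [zero_add, zero_smul, add_zero, smul_eq_mul]
  rw [inv_mul_eq_div, le_div_iff₀ ht.1]
  linarith

/-- A composite proximal step contracts towards a point `s` at which `-v` is a subgradient of `R`,
up to the mismatch between `v` and the shifted gradient of `h`. -/
lemma norm_prox_sub_le {E : Type*} [NormedAddCommGroup E] [InnerProductSpace ℝ E] [CompleteSpace E]
    {h R : E → ℝ} {μ η : ℝ} {p a s v : E} (hη : 0 < η)
    (hdiff : DifferentiableAt ℝ h p)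
    (hsc : ∀ x y : E, h y + ⟪gradient h y, x - y⟫ + μ / 2 * ‖x - y‖ ^ 2 ≤ h x)
    (hR : ConvexOn ℝ Set.univ R)
    (hp : ∀ z : E, η * (h p + R p) + (1 / 2) * ‖p - a‖ ^ 2 ≤
      η * (h z + R z) + (1 / 2) * ‖z - a‖ ^ 2)
    (hs : R s - R p ≤ ⟪v, p - s⟫) :
    (1 + η * μ) * ‖p - s‖ ≤ ‖a - s - η • (gradient h s - v)‖ := by
  have hquad : HasFDerivAt (fun z => η * h z + (1 / 2) * ‖z - a‖ ^ 2)
      (η • InnerProductSpace.toDual ℝ E (gradient h p) +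
        (1 / 2 : ℝ) • (2 • (innerSL ℝ (p - a)).comp (ContinuousLinearMap.id ℝ E))) p :=
    (hdiff.hasGradientAt.hasFDerivAt.const_mul η).add
      (((hasFDerivAt_id p).sub_const a).norm_sq.const_mul (1 / 2))
  have hfo := sub_le_fderiv_of_isMin_add_convex hquad (hR.smul hη.le)
    (fun z => by have := hp z; simp only [smul_eq_mul]; linarith) s
  simp only [smul_eq_mul, add_apply, smul_apply,
    InnerProductSpace.toDual_apply_apply, ContinuousLinearMap.comp_apply, innerSL_apply_apply,
    ContinuousLinearMap.id_apply, nsmul_eq_mul] at hfo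
  have h1 := hsc s p
  have h2 := hsc p s
  have hs' := mul_le_mul_of_nonneg_left hs hη.le
  have hmono : η * (μ * ‖p - s‖ ^ 2) ≤
      η * (⟪gradient h p, p - s⟫ - ⟪gradient h s, p - s⟫) := by
    refine mul_le_mul_of_nonneg_left ?_ hη.le
    rw [norm_sub_rev s p, ← neg_sub p s, inner_neg_right] at h1
    linarith
  have hinner : (1 + η * μ) * ‖p - s‖ ^ 2 ≤ ⟪a - s - η • (gradient h s - v), p - s⟫ := by
    have hpa : ⟪a - s, p - s⟫ = ‖p - s‖ ^ 2 - ⟪p - a, p - s⟫ := by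
      rw [← real_inner_self_eq_norm_sq, ← inner_sub_left]
      congr 1
      abel
    rw [← neg_sub p s, inner_neg_right, inner_neg_right] at hfo
    rw [inner_sub_left (a - s), inner_smul_left, inner_sub_left (gradient h s), hpa]
    simp only [conj_trivial]
    push_cast at hfo
    linarith
  have hcs := hinner.trans (real_inner_le_norm _ _)
  rcases (norm_nonneg (p - s)).eq_or_lt with h0 | h0
  · rw [← h0, mul_zero]
    exact norm_nonneg _
  · refine le_of_mul_le_mul_right ?_ h0
    linarith

/-- The bias-variance identity for the mean square norm, with centered noise `e`. -/
lemma sum_norm_sub_smul_sq_of_sum_eq_zero {ι E : Type*} [Fintype ι] [NormedAddCommGroup E]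
    [InnerProductSpace ℝ E] (u : E) (η : ℝ) {e : ι → E} (he : ∑ i, e i = 0) :
    ∑ i, ‖u - η • e i‖ ^ 2 = Fintype.card ι * ‖u‖ ^ 2 + η ^ 2 * ∑ i, ‖e i‖ ^ 2 := by
  simp only [norm_sub_sq_real, inner_smul_right, norm_smul, mul_pow, Real.norm_eq_abs, sq_abs,
    Finset.sum_add_distrib, Finset.sum_sub_distrib, ← Finset.mul_sum, ← inner_sum, he,
    inner_zero_right]
  simp

/-- Core variance-reduction step of SVRP for composite optimization: with
`g_m = ∇f(w) − ∇f_m(w)` and `x_*` a minimizer of `F = f + R`,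
`(1/M)·Σ ‖prox_{η(f_m+R)}(x − η g_m) − x_*‖²
  ≤ (1/(1+ημ)²)·[‖x − x_*‖² + η²δ²‖w − x_*‖²]`. -/
theorem svrp_composite_one_step
    {E : Type*} [NormedAddCommGroup E] [InnerProductSpace ℝ E] [CompleteSpace E]
    (M : ℕ) (hM : 0 < M) (f : Fin M → E → ℝ) (μ δ : ℝ) (hμ : 0 < μ)
    (hdiff : ∀ m x, DifferentiableAt ℝ (f m) x)
    (hsc : ∀ m, ∀ x y : E,
      f m y + ⟪gradient (f m) y, x - y⟫ + μ / 2 * ‖x - y‖ ^ 2 ≤ f m x)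
    (hsim : ∀ x y : E,
      (1 / (M : ℝ)) * ∑ m : Fin M,
          ‖gradient (f m) x - gradient (fun z => (1 / (M : ℝ)) * ∑ i : Fin M, f i z) x -
            (gradient (f m) y - gradient (fun z => (1 / (M : ℝ)) * ∑ i : Fin M, f i z) y)‖ ^ 2 ≤
        δ ^ 2 * ‖x - y‖ ^ 2)
    (R : E → ℝ) (hR : ConvexOn ℝ Set.univ R)
    (xstar : E)
    (hmin : ∀ x : E,
      ((1 / (M : ℝ)) * ∑ m : Fin M, f m xstar) + R xstar ≤
        ((1 / (M : ℝ)) * ∑ m : Fin M, f m x) + R x)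
    (η : ℝ) (hη : 0 < η) (x w : E) (g : Fin M → E)
    (hg : ∀ m,
      g m = gradient (fun z => (1 / (M : ℝ)) * ∑ i : Fin M, f i z) w - gradient (f m) w)
    (p : Fin M → E)
    (hp : ∀ m, ∀ z : E,
      η * (f m (p m) + R (p m)) + (1 / 2) * ‖p m - (x - η • g m)‖ ^ 2 ≤
        η * (f m z + R z) + (1 / 2) * ‖z - (x - η • g m)‖ ^ 2) :
    (1 / (M : ℝ)) * ∑ m : Fin M, ‖p m - xstar‖ ^ 2 ≤
      (1 / (1 + η * μ) ^ 2) *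
        (‖x - xstar‖ ^ 2 + η ^ 2 * δ ^ 2 * ‖w - xstar‖ ^ 2) := by
  set F : E → ℝ := fun z => (1 / (M : ℝ)) * ∑ i : Fin M, f i z with hF
  have hM' : (0 : ℝ) < M := by exact_mod_cast hM
  have hFgrad (y : E) : HasGradientAt F ((1 / (M : ℝ)) • ∑ i, gradient (f i) y) y := by
    rw [hasGradientAt_iff_hasFDerivAt]
    have := (HasFDerivAt.fun_sum (u := Finset.univ)
      fun i _ => (hdiff i y).hasGradientAt.hasFDerivAt).const_mul (1 / (M : ℝ))
    simpa only [map_smul, map_sum] using this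
  have hsum (y : E) : ∑ i, (gradient (f i) y - gradient F y) = 0 := by
    rw [(hFgrad y).gradient]
    simp [Finset.sum_sub_distrib, ← Nat.cast_smul_eq_nsmul ℝ, smul_smul, hM'.ne']
  set e : Fin M → E := fun m =>
    gradient (f m) xstar - gradient F xstar - (gradient (f m) w - gradient F w) with he
  have hesum : ∑ m, e m = 0 := by
    simp only [he]
    rw [Finset.sum_sub_distrib, hsum, hsum, sub_zero]
  have hstep (m : Fin M) : (1 + η * μ) ^ 2 * ‖p m - xstar‖ ^ 2 ≤ ‖x - xstar - η • e m‖ ^ 2 := by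
    have hs := sub_le_fderiv_of_isMin_add_convex
      (hFgrad xstar).differentiableAt.hasGradientAt.hasFDerivAt hR hmin (p m)
    rw [InnerProductSpace.toDual_apply_apply] at hs
    have hle := norm_prox_sub_le hη (hdiff m _) (hsc m) hR (hp m) hs
    have hvec : x - η • g m - xstar - η • (gradient (f m) xstar - gradient F xstar) =
        x - xstar - η • e m := by
      simp only [hg, he]
      module
    rw [hvec] at hle
    rw [← mul_pow]
    exact pow_le_pow_left₀ (by positivity) hle 2
  have htotal := Finset.sum_le_sum fun m (_ : m ∈ Finset.univ) => hstep m
  rw [← Finset.mul_sum, sum_norm_sub_smul_sq_of_sum_eq_zero _ _ hesum, Fintype.card_fin] at htotal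
  have hvar := mul_le_mul_of_nonneg_left (hsim xstar w) (sq_nonneg η)
  rw [norm_sub_rev xstar w] at hvar
  rw [one_div_mul_eq_div ((1 + η * μ) ^ 2), le_div_iff₀ (by positivity)]
  calc (1 / (M : ℝ)) * (∑ m, ‖p m - xstar‖ ^ 2) * (1 + η * μ) ^ 2
      = (1 / (M : ℝ)) * ((1 + η * μ) ^ 2 * ∑ m, ‖p m - xstar‖ ^ 2) := by ring
    _ ≤ (1 / (M : ℝ)) * (M * ‖x - xstar‖ ^ 2 + η ^ 2 * ∑ m, ‖e m‖ ^ 2) := by gcongr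
    _ = ‖x - xstar‖ ^ 2 + η ^ 2 * ((1 / (M : ℝ)) * ∑ m, ‖e m‖ ^ 2) := by field_simp
    _ ≤ _ := by linarith
end
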